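/- Let k be a field of characteristic zero, A = k[X₀,X₁,X₂] the polynomial ring in three variables, τ a k-derivation of A, and set P = τ(X₀), Q = τ(X₁), R = τ(X₂). Then the subset { ⁅τ, f·τ⁆ + ⁅X₁·τ, g·τ⁆ + ⁅X₂·τ, h·τ⁆ : f, g, h ∈ A } of Der_k(A) is equal to { s·τ : s ∈ (P,Q,R) }, where (P,Q,R) denotes the ideal of A generated by P, Q and R. -/

import Mathlib

set_option synthInstance.maxHeartbeats 1000000
set_option maxHeartbeats 2000000

theorem MvPolynomial.pderiv_surjective {σ k : Type*} [Field k] [CharZero k] (i : σ) :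
    Function.Surjective (MvPolynomial.pderiv (R := k) i) := by
  intro p
  induction p using MvPolynomial.induction_on' with
  | monomial u a =>
    refine ⟨MvPolynomial.monomial (u + Finsupp.single i 1) (a / ((u i : k) + 1)), ?_⟩
    have h : (u i : k) + 1 ≠ 0 := by exact_mod_cast Nat.succ_ne_zero (u i)
    rw [MvPolynomial.pderiv_monomial, add_tsub_cancel_right]
    congr 1
    simp only [Finsupp.add_apply, Finsupp.single_eq_same, Nat.cast_add, Nat.cast_one]
    field_simp
  | add p q hp hq =>
    obtain ⟨f, rfl⟩ := hp
    obtain ⟨g, rfl⟩ := hq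
    exact ⟨f + g, map_add _ f g⟩

theorem MvPolynomial.derivation_apply_eq_sum_pderiv {σ k : Type*} [Fintype σ] [CommRing k]
    (τ : Derivation k (MvPolynomial σ k) (MvPolynomial σ k)) (f : MvPolynomial σ k) :
    τ f = ∑ i, MvPolynomial.pderiv i f * τ (MvPolynomial.X i) := by
  classical
  have sum_apply (x : MvPolynomial σ k) :
      (∑ i, τ (MvPolynomial.X i) • MvPolynomial.pderiv i) x =
        ∑ i, τ (MvPolynomial.X i) * MvPolynomial.pderiv i x := by
    rw [← Derivation.coeFnAddMonoidHom_apply, map_sum, Finset.sum_apply]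
    rfl
  have h : τ = ∑ i, τ (MvPolynomial.X i) • MvPolynomial.pderiv i := by
    refine MvPolynomial.derivation_ext fun j => ?_
    rw [sum_apply]
    simp [MvPolynomial.pderiv_X, Pi.single_apply]
  conv_lhs => rw [h, sum_apply]
  simp only [mul_comm]

theorem Derivation.lie_smul_smul_self {k A : Type*} [CommRing k] [CommRing A] [Algebra k A]
    (τ : Derivation k A A) (a b : A) :
    ⁅a • τ, b • τ⁆ = (a * τ b - b * τ a) • τ := by
  ext x
  simp only [Derivation.commutator_apply, Derivation.smul_apply, smul_eq_mul, Derivation.leibniz]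
  ring

/-- Claim 1 in the proof of Theorem A. -/
theorem stmt_7 (k : Type*) [Field k] [CharZero k]
    (τ : Derivation k (MvPolynomial (Fin 3) k) (MvPolynomial (Fin 3) k))
    (P Q R : MvPolynomial (Fin 3) k)
    (hP : P = τ (MvPolynomial.X 0)) (hQ : Q = τ (MvPolynomial.X 1))
    (hR : R = τ (MvPolynomial.X 2)) :
    {D : Derivation k (MvPolynomial (Fin 3) k) (MvPolynomial (Fin 3) k) |
      ∃ f g h : MvPolynomial (Fin 3) k,
        D = ⁅τ, f • τ⁆ + ⁅(MvPolynomial.X 1 : MvPolynomial (Fin 3) k) • τ, g • τ⁆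
          + ⁅(MvPolynomial.X 2 : MvPolynomial (Fin 3) k) • τ, h • τ⁆} =
    {D : Derivation k (MvPolynomial (Fin 3) k) (MvPolynomial (Fin 3) k) |
      ∃ s ∈ Ideal.span {P, Q, R}, D = s • τ} := by
  subst hP hQ hR
  have key (f g h : MvPolynomial (Fin 3) k) :
      ⁅τ, f • τ⁆ + ⁅(MvPolynomial.X 1 : MvPolynomial (Fin 3) k) • τ, g • τ⁆
          + ⁅(MvPolynomial.X 2 : MvPolynomial (Fin 3) k) • τ, h • τ⁆ =
        (τ f + (MvPolynomial.X 1 * τ g - g * τ (MvPolynomial.X 1))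
          + (MvPolynomial.X 2 * τ h - h * τ (MvPolynomial.X 2))) • τ := by
    have h₁ := Derivation.lie_smul_smul_self τ 1 f
    rw [one_smul, one_mul, Derivation.map_one_eq_zero, mul_zero, sub_zero] at h₁
    rw [h₁, Derivation.lie_smul_smul_self, Derivation.lie_smul_smul_self, add_smul, add_smul]
  have hτ (f : MvPolynomial (Fin 3) k) :
      τ f = MvPolynomial.pderiv 0 f * τ (MvPolynomial.X 0)
        + MvPolynomial.pderiv 1 f * τ (MvPolynomial.X 1)
        + MvPolynomial.pderiv 2 f * τ (MvPolynomial.X 2) := by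
    rw [MvPolynomial.derivation_apply_eq_sum_pderiv, Fin.sum_univ_three]
  ext D
  simp only [Set.mem_ofPred_eq, key, Submodule.mem_span_triple, smul_eq_mul]
  constructor
  · rintro ⟨f, g, h, rfl⟩
    refine ⟨_, ⟨MvPolynomial.pderiv 0 f + MvPolynomial.X 1 * MvPolynomial.pderiv 0 g
        + MvPolynomial.X 2 * MvPolynomial.pderiv 0 h,
      MvPolynomial.pderiv 1 f + MvPolynomial.X 1 * MvPolynomial.pderiv 1 g - g
        + MvPolynomial.X 2 * MvPolynomial.pderiv 1 h,
      MvPolynomial.pderiv 2 f + MvPolynomial.X 1 * MvPolynomial.pderiv 2 g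
        + MvPolynomial.X 2 * MvPolynomial.pderiv 2 h - h, ?_⟩, rfl⟩
    rw [hτ f, hτ g, hτ h]
    ring
  · rintro ⟨_, ⟨a, b, c, rfl⟩, rfl⟩
    obtain ⟨F, rfl⟩ := MvPolynomial.pderiv_surjective 0 a
    have half : (MvPolynomial.C (2⁻¹ : k) : MvPolynomial (Fin 3) k) * 2 = 1 := by
      rw [← map_ofNat (MvPolynomial.C (R := k) (σ := Fin 3)) 2, ← map_mul,
        inv_mul_cancel₀ two_ne_zero, map_one]
    let g := MvPolynomial.C (2⁻¹ : k) * (MvPolynomial.pderiv 1 F - b)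
    let h := MvPolynomial.C (2⁻¹ : k) * (MvPolynomial.pderiv 2 F - c)
    have hg : 2 * g = MvPolynomial.pderiv 1 F - b := by
      linear_combination (MvPolynomial.pderiv 1 F - b) * half
    have hh : 2 * h = MvPolynomial.pderiv 2 F - c := by
      linear_combination (MvPolynomial.pderiv 2 F - c) * half
    refine ⟨F - MvPolynomial.X 1 * g - MvPolynomial.X 2 * h, g, h, ?_⟩
    congr 1
    simp only [map_sub, Derivation.leibniz, smul_eq_mul]
    linear_combination -hτ F + τ (MvPolynomial.X 1) * hg + τ (MvPolynomial.X 2) * hh
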